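/- Lower semicontinuity of the feasible-flow correspondence (sequential form): Let 𝒢 be a connected oriented graph with incidence matrix B and finite capacities λ̄_k ∈ (0,∞). For b ∈ ℝ^n define Δ(b) = { λ ∈ ℝ^m : Bλ = −b and −λ̄_k ≤ λ_k ≤ λ̄_k for all k }. Fix ε > 0 and let b and a sequence (b_j) in ℝ^n all satisfy 1_nᵀ b = 0, 1_nᵀ b_j = 0 and, for every nonempty proper subset S ⊂ V, |Σ_{i∈S} b_i| ≤ λ̄_{Q(S)} − ε and |Σ_{i∈S} (b_j)_i| ≤ λ̄_{Q(S)} − ε. If b_j → b and λ ∈ Δ(b), then there exist λ_j ∈ Δ(b_j) with λ_j → λ. -/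

import Mathlib

open Matrix

open Finset in
/-- The edges with exactly one endpoint in `S`. -/
def inducedCut {n m : ℕ} (src dst : Fin m → Fin n) (S : Finset (Fin n)) : Finset (Fin m) :=
  univ.filter fun k => (src k ∈ S ∧ dst k ∉ S) ∨ (src k ∉ S ∧ dst k ∈ S)

/-- The oriented incidence matrix of a graph given by its source and target maps. -/
def incidence {n m : ℕ} (src dst : Fin m → Fin n) : Matrix (Fin n) (Fin m) ℝ :=
  Matrix.of fun i k => if i = src k then (1 : ℝ) else if i = dst k then -1 else 0

section Flow

variable {n m : ℕ} {src dst : Fin m → Fin n}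

lemma incidence_apply (hloop : ∀ k, src k ≠ dst k) (i : Fin n) (k : Fin m) :
    incidence src dst i k = (if i = src k then 1 else 0) - (if i = dst k then 1 else 0) := by
  have := hloop k
  simp only [incidence, Matrix.of_apply]
  split_ifs <;> grind

lemma sum_incidence_mulVec (hloop : ∀ k, src k ≠ dst k) (S : Finset (Fin n)) (x : Fin m → ℝ) :
    ∑ i ∈ S, (incidence src dst).mulVec x i =
      ∑ k, ((if src k ∈ S then 1 else 0) - (if dst k ∈ S then 1 else 0)) * x k := by
  simp only [Matrix.mulVec, dotProduct]
  rw [Finset.sum_comm]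
  refine Finset.sum_congr rfl fun k _ => ?_
  rw [← Finset.sum_mul]
  simp [incidence_apply hloop, Finset.sum_sub_distrib]

lemma sum_sq_add_single_column (hloop : ∀ k, src k ≠ dst k) (p : Fin n → ℝ) (k : Fin m) (t : ℝ) :
    ∑ i, (p i + t * incidence src dst i k) ^ 2 =
      ∑ i, p i ^ 2 + 2 * t * (p (src k) - p (dst k)) + 2 * t ^ 2 := by
  have h : ∀ i, (p i + t * incidence src dst i k) ^ 2 = p i ^ 2
      + 2 * t * ((if i = src k then p i else 0) - (if i = dst k then p i else 0))
      + t ^ 2 * ((if i = src k then 1 else 0) + (if i = dst k then 1 else 0)) := by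
    intro i
    have := hloop k
    rw [incidence_apply hloop]
    split_ifs <;> grind
  simp only [h, Finset.sum_add_distrib, ← Finset.mul_sum, Finset.sum_sub_distrib]
  simp
  ring

/-- At a least-squares residual `p`, every edge along which `p` is not constant is saturated. -/
lemma saturated_of_isMinOn (hloop : ∀ k, src k ≠ dst k) {c : Fin m → ℝ} {b : Fin n → ℝ}
    {x : Fin m → ℝ} (hx : x ∈ Set.Icc (-c) c)
    (hmin : IsMinOn (fun y => ∑ i, ((incidence src dst).mulVec y i + b i) ^ 2)
      (Set.Icc (-c) c) x) (k : Fin m) :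
    let p := fun i => (incidence src dst).mulVec x i + b i
    (p (dst k) < p (src k) → x k = -c k) ∧ (p (src k) < p (dst k) → x k = c k) := by
  intro p
  have hk1 : -c k ≤ x k := hx.1 k
  have hk2 : x k ≤ c k := hx.2 k
  have key : ∀ t, -c k ≤ x k + t → x k + t ≤ c k →
      0 ≤ t * (p (src k) - p (dst k)) + t ^ 2 := by
    intro t h1 h2
    have hmem : x + Pi.single k t ∈ Set.Icc (-c) c := by
      constructor <;> intro l <;> by_cases hl : l = k
      · subst hl; simpa using h1
      · simpa [hl] using hx.1 l
      · subst hl; simpa using h2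
      · simpa [hl] using hx.2 l
    have h := hmin hmem
    simp only [Set.mem_ofPred_eq] at h
    have hs := sum_sq_add_single_column hloop p k t
    have he : ∀ i, (incidence src dst).mulVec (x + Pi.single k t) i + b i =
        p i + t * incidence src dst i k := by
      intro i
      simp only [Matrix.mulVec_add, Pi.add_apply, Matrix.mulVec_single, p]
      simp
      ring
    simp only [he] at h
    change ∑ i, p i ^ 2 ≤ _ at h
    linarith
  constructor <;> intro hp <;> by_contra hne
  · have hlt : 0 < x k + c k := by
      have := lt_of_le_of_ne hk1 (Ne.symm hne)
      linarith
    set s := min (x k + c k) ((p (src k) - p (dst k)) / 2)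
    have hs0 : 0 < s := lt_min hlt (by linarith)
    have hs1 : s ≤ x k + c k := min_le_left _ _
    have hs2 : s ≤ (p (src k) - p (dst k)) / 2 := min_le_right _ _
    have := key (-s) (by linarith) (by linarith)
    nlinarith
  · have hlt : 0 < c k - x k := by
      have := lt_of_le_of_ne hk2 hne
      linarith
    set s := min (c k - x k) ((p (dst k) - p (src k)) / 2)
    have hs0 : 0 < s := lt_min hlt (by linarith)
    have hs1 : s ≤ c k - x k := min_le_left _ _
    have hs2 : s ≤ (p (dst k) - p (src k)) / 2 := min_le_right _ _
    have := key s (by linarith) (by linarith)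
    nlinarith

/-- Gale's feasibility theorem: the cut condition suffices for the existence of a flow. -/
theorem exists_flow_of_cut_condition (hloop : ∀ k, src k ≠ dst k) {c : Fin m → ℝ}
    (hc : ∀ k, 0 ≤ c k) {b : Fin n → ℝ} (hb : ∑ i, b i = 0)
    (hcut : ∀ S : Finset (Fin n), S.Nonempty → S ≠ Finset.univ →
      ∑ i ∈ S, b i ≤ ∑ k ∈ inducedCut src dst S, c k) :
    ∃ x : Fin m → ℝ, (incidence src dst).mulVec x = -b ∧ ∀ k, |x k| ≤ c k := by
  have hne : (Set.Icc (-c) c).Nonempty :=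
    ⟨0, fun k => by simpa using hc k, fun k => hc k⟩
  have hcont : Continuous fun y : Fin m → ℝ =>
      ∑ i, ((incidence src dst).mulVec y i + b i) ^ 2 := by
    simp only [Matrix.mulVec, dotProduct]
    fun_prop
  obtain ⟨x, hx, hmin⟩ := isCompact_Icc.exists_isMinOn hne hcont.continuousOn
  have hsat := saturated_of_isMinOn hloop hx hmin
  refine ⟨x, ?_, fun k => abs_le.2 ⟨hx.1 k, hx.2 k⟩⟩
  set p : Fin n → ℝ := fun i => (incidence src dst).mulVec x i + b i with hp
  have hcut' : ∀ S : Finset (Fin n), ∑ i ∈ S, b i ≤ ∑ k ∈ inducedCut src dst S, c k := by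
    intro S
    have h0 : 0 ≤ ∑ k ∈ inducedCut src dst S, c k := Finset.sum_nonneg fun k _ => hc k
    rcases S.eq_empty_or_nonempty with rfl | hS
    · simpa using h0
    by_cases hu : S = Finset.univ
    · rw [hu] at h0 ⊢
      rwa [hb]
    · exact hcut S hS hu
  have hle : ∀ i, p i ≤ 0 := by
    set S := Finset.univ.filter fun i => 0 < p i with hS
    have hflow : ∑ i ∈ S, (incidence src dst).mulVec x i =
        -∑ k ∈ inducedCut src dst S, c k := by
      rw [sum_incidence_mulVec hloop, inducedCut, Finset.sum_filter, ← Finset.sum_neg_distrib]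
      refine Finset.sum_congr rfl fun k _ => ?_
      obtain ⟨h1, h2⟩ := hsat k
      simp only [hS, Finset.mem_filter, Finset.mem_univ, true_and]
      by_cases hs : 0 < p (src k) <;> by_cases hd : 0 < p (dst k)
      · simp [hs, hd]
      · simp [hs, hd, h1 (by linarith)]
      · simp [hs, hd, h2 (by linarith)]
      · simp [hs, hd]
    have hsum : ∑ i ∈ S, p i ≤ 0 := by
      rw [hp, Finset.sum_add_distrib, hflow]
      linarith [hcut' S]
    intro i
    by_contra! hi
    have hpos : 0 < ∑ i ∈ S, p i :=
      Finset.sum_pos (fun i hi => (Finset.mem_filter.1 hi).2) ⟨i, by simp [hS, hi]⟩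
    linarith
  have hsum : ∑ i, p i = 0 := by
    rw [hp, Finset.sum_add_distrib, hb, sum_incidence_mulVec hloop]
    simp
  funext i
  have := (Finset.sum_eq_zero_iff_of_nonpos fun i _ => hle i).1 hsum i (Finset.mem_univ i)
  simp only [hp] at this
  simp only [Pi.neg_apply]
  linarith

lemma inducedCut_nonempty
    (hconn : ∀ i j : Fin n, Relation.ReflTransGen
      (fun a b => ∃ k, (src k = a ∧ dst k = b) ∨ (src k = b ∧ dst k = a)) i j)
    {S : Finset (Fin n)} (hS : S.Nonempty) (hu : S ≠ Finset.univ) :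
    (inducedCut src dst S).Nonempty := by
  obtain ⟨i, hi⟩ := hS
  obtain ⟨j, hj⟩ : ∃ j, j ∉ S := by
    by_contra! h
    exact hu (Finset.eq_univ_iff_forall.2 h)
  by_contra hemp
  rw [Finset.not_nonempty_iff_eq_empty] at hemp
  refine hj ?_
  induction hconn i j with
  | refl => exact hi
  | @tail a d _ hstep ih =>
    by_contra hd
    obtain ⟨k, hk⟩ := hstep
    have ha : a ∈ S := by
      by_contra ha
      exact ha (ih ha)
    have : k ∈ inducedCut src dst S := by
      rcases hk with ⟨rfl, rfl⟩ | ⟨rfl, rfl⟩ <;> simp [inducedCut, ha, hd]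
    simp [hemp] at this

/-- In a connected graph, a balanced injection is routed by a flow of comparable size. -/
lemma exists_flow_le_sum_abs (hloop : ∀ k, src k ≠ dst k)
    (hconn : ∀ i j : Fin n, Relation.ReflTransGen
      (fun a b => ∃ k, (src k = a ∧ dst k = b) ∨ (src k = b ∧ dst k = a)) i j)
    {d : Fin n → ℝ} (hd : ∑ i, d i = 0) :
    ∃ r : Fin m → ℝ, (incidence src dst).mulVec r = -d ∧ ∀ k, |r k| ≤ ∑ i, |d i| := by
  have hD : 0 ≤ ∑ i, |d i| := Finset.sum_nonneg fun i _ => abs_nonneg _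
  refine exists_flow_of_cut_condition hloop (fun _ => hD) hd fun S hS hu => ?_
  obtain ⟨k, hk⟩ := inducedCut_nonempty hconn hS hu
  calc ∑ i ∈ S, d i ≤ ∑ i ∈ S, |d i| := Finset.sum_le_sum fun i _ => le_abs_self _
    _ ≤ ∑ i, |d i| :=
      Finset.sum_le_sum_of_subset_of_nonneg (Finset.subset_univ S) fun i _ _ => abs_nonneg _
    _ ≤ ∑ _k ∈ inducedCut src dst S, ∑ i, |d i| :=
      Finset.single_le_sum (f := fun _ => ∑ i, |d i|) (fun _ _ => hD) hk

/-- A uniform slack in the cut conditions yields a flow with uniform relative slack. -/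
lemma exists_flow_with_slack (hloop : ∀ k, src k ≠ dst k) {c : Fin m → ℝ}
    (hc : ∀ k, 0 < c k) {ε : ℝ} (hε : 0 < ε) {b : Fin n → ℝ} (hb : ∑ i, b i = 0)
    (hcut : ∀ S : Finset (Fin n), S.Nonempty → S ≠ Finset.univ →
      |∑ i ∈ S, b i| ≤ (∑ k ∈ inducedCut src dst S, c k) - ε) :
    ∃ δ : ℝ, 0 < δ ∧ ∃ x : Fin m → ℝ,
      (incidence src dst).mulVec x = -b ∧ ∀ k, |x k| ≤ (1 - δ) * c k := by
  have hM : 0 ≤ ∑ k, c k := Finset.sum_nonneg fun k _ => (hc k).le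
  have hδ : 0 < ε / (∑ k, c k + ε) := by positivity
  have hδ1 : ε / (∑ k, c k + ε) ≤ 1 := (div_le_one (by positivity)).2 (by linarith)
  have hδM : ε / (∑ k, c k + ε) * ∑ k, c k ≤ ε := by
    rw [div_mul_eq_mul_div, div_le_iff₀ (by positivity)]
    nlinarith
  refine ⟨_, hδ, exists_flow_of_cut_condition hloop
    (fun k => mul_nonneg (by linarith) (hc k).le) hb fun S hS hu => ?_⟩
  have hle : ∑ k ∈ inducedCut src dst S, c k ≤ ∑ k, c k :=
    Finset.sum_le_sum_of_subset_of_nonneg (Finset.subset_univ _) fun k _ _ => (hc k).le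
  rw [← Finset.mul_sum]
  have := mul_le_mul_of_nonneg_left hle hδ.le
  linarith [le_abs_self (∑ i ∈ S, b i), hcut S hS hu]

end Flow

/-- Lower semicontinuity of the feasible-flow correspondence (sequential form). -/
theorem feasible_flow_lower_semicontinuous {n m : ℕ}
    (src dst : Fin m → Fin n) (hloop : ∀ k, src k ≠ dst k)
    (hconn : ∀ i j : Fin n, Relation.ReflTransGen
      (fun a b => ∃ k, (src k = a ∧ dst k = b) ∨ (src k = b ∧ dst k = a)) i j)
    (B : Matrix (Fin n) (Fin m) ℝ)
    (hB : B = Matrix.of fun i k => if i = src k then (1 : ℝ) else if i = dst k then -1 else 0)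
    (lamBar : Fin m → ℝ) (hcap : ∀ k, 0 < lamBar k)
    (ε : ℝ) (hε : 0 < ε)
    (b : Fin n → ℝ) (bseq : ℕ → Fin n → ℝ)
    (hbalb : ∑ i, b i = 0) (hbalseq : ∀ j, ∑ i, bseq j i = 0)
    (hcutb : ∀ S : Finset (Fin n), S.Nonempty → S ≠ Finset.univ →
      |∑ i ∈ S, b i| ≤
        (∑ k ∈ Finset.univ.filter
          (fun k => (src k ∈ S ∧ dst k ∉ S) ∨ (src k ∉ S ∧ dst k ∈ S)), lamBar k) - ε)
    (hcutseq : ∀ j, ∀ S : Finset (Fin n), S.Nonempty → S ≠ Finset.univ →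
      |∑ i ∈ S, bseq j i| ≤
        (∑ k ∈ Finset.univ.filter
          (fun k => (src k ∈ S ∧ dst k ∉ S) ∨ (src k ∉ S ∧ dst k ∈ S)), lamBar k) - ε)
    (htend : Filter.Tendsto bseq Filter.atTop (nhds b))
    (lam : Fin m → ℝ)
    (hlamfeas : B.mulVec lam = -b ∧ ∀ k, |lam k| ≤ lamBar k) :
    ∃ lamseq : ℕ → Fin m → ℝ,
      (∀ j, B.mulVec (lamseq j) = -(bseq j) ∧ ∀ k, |lamseq j k| ≤ lamBar k) ∧
      Filter.Tendsto lamseq Filter.atTop (nhds lam) := by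
  change B = incidence src dst at hB
  subst hB
  obtain ⟨hlam, hlamle⟩ := hlamfeas
  obtain ⟨δ, hδ, μ, hμ, hμle⟩ := exists_flow_with_slack hloop hcap hε hbalb hcutb
  have hex : ∀ j, ∃ x : Fin m → ℝ,
      (incidence src dst).mulVec x = -(bseq j) ∧ ∀ k, |x k| ≤ lamBar k := fun j =>
    exists_flow_of_cut_condition hloop (fun k => (hcap k).le) (hbalseq j) fun S hS hu =>
      (le_abs_self _).trans ((hcutseq j S hS hu).trans (sub_le_self _ hε.le))
  choose ν hν hνle using hex
  have hrex : ∀ j, ∃ r : Fin m → ℝ, (incidence src dst).mulVec r = -(bseq j - b) ∧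
      ∀ k, |r k| ≤ ∑ i, |(bseq j - b) i| := fun j =>
    exists_flow_le_sum_abs hloop hconn (by simp [hbalb, hbalseq j])
  choose r hr hrle using hrex
  set D : ℕ → ℝ := fun j => ∑ i, |(bseq j - b) i|
  have hD0 : ∀ j, 0 ≤ D j := fun j => Finset.sum_nonneg fun i _ => abs_nonneg _
  have hD : Filter.Tendsto D Filter.atTop (nhds 0) := by
    have hcont : Continuous fun v : Fin n → ℝ => ∑ i, |(v - b) i| := by
      simp only [Pi.sub_apply]
      fun_prop
    have h := (hcont.tendsto b).comp htend
    simp only [sub_self, Pi.zero_apply, abs_zero, Finset.sum_const_zero] at h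
    exact h
  have hrlim : Filter.Tendsto r Filter.atTop (nhds 0) :=
    tendsto_pi_nhds.2 fun k => squeeze_zero_norm (fun j => hrle j k) hD
  set A : ℝ := ∑ k, 1 / (δ * lamBar k)
  have hA0 : 0 ≤ A := Finset.sum_nonneg fun k _ => by have := hcap k; positivity
  have hA : ∀ k, 1 ≤ A * (δ * lamBar k) := fun k => by
    have hpos : 0 < δ * lamBar k := mul_pos hδ (hcap k)
    rw [← div_le_iff₀ hpos]
    exact Finset.single_le_sum (f := fun k => 1 / (δ * lamBar k))
      (fun k _ => by have := hcap k; positivity) (Finset.mem_univ k)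
  have ht : Filter.Tendsto (fun j => D j * A) Filter.atTop (nhds 0) := by
    simpa using hD.mul_const A
  refine ⟨fun j => if D j * A ≤ 1 then (1 - D j * A) • lam + (D j * A) • μ + r j else ν j,
    fun j => ?_, ?_⟩
  · by_cases h : D j * A ≤ 1
    · simp only [if_pos h]
      refine ⟨?_, fun k => ?_⟩
      · rw [Matrix.mulVec_add, Matrix.mulVec_add, Matrix.mulVec_smul, Matrix.mulVec_smul,
          hlam, hμ, hr]
        module
      · have ht0 : 0 ≤ D j * A := mul_nonneg (hD0 j) hA0
        have h1 := mul_le_mul_of_nonneg_left (hlamle k) (sub_nonneg.2 h)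
        have h2 := mul_le_mul_of_nonneg_left (hμle k) ht0
        have h3 := mul_le_mul_of_nonneg_left (hA k) (hD0 j)
        have h4 : |r j k| ≤ D j := hrle j k
        simp only [Pi.add_apply, Pi.smul_apply, smul_eq_mul]
        calc |(1 - D j * A) * lam k + D j * A * μ k + r j k|
            ≤ |(1 - D j * A) * lam k| + |D j * A * μ k| + |r j k| := abs_add_three _ _ _
          _ = (1 - D j * A) * |lam k| + D j * A * |μ k| + |r j k| := by
            rw [abs_mul, abs_mul, abs_of_nonneg (sub_nonneg.2 h), abs_of_nonneg ht0]
          _ ≤ lamBar k := by linarith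
    · simp only [if_neg h]
      exact ⟨hν j, hνle j⟩
  · have hlim : Filter.Tendsto (fun j => (1 - D j * A) • lam + (D j * A) • μ + r j)
        Filter.atTop (nhds lam) := by
      simpa using (((ht.const_sub 1).smul_const lam).add (ht.smul_const μ)).add hrlim
    refine hlim.congr' ?_
    filter_upwards [ht.eventually_le_const one_pos] with j hj
    rw [if_pos hj]
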